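/- Let r_0, r_1, r_2, r_3 ∈ M_2(ℂ) satisfy ρ_1(r_j* r_k) = δ_{jk} and fix 1 ≤ p ≤ ∞. Then: (i) for every 0 ≤ m ≤ 3 and complex scalars, ‖Σ_{j=0}^{m} α_j r_j‖_{p,♯} ≤ (Σ_{j=0}^{3} ‖r_j‖·‖r_j‖_{p,♯}) · ‖Σ_{j=0}^{3} α_j r_j‖_{p,♯}; and (ii) if c ≥ 0 is such that ‖Σ_{j=0}^{m} α_j h^{(ν)}_j‖_{p,♯} ≤ c·‖Σ_{j=0}^{4^ν−1} α_j h^{(ν)}_j‖_{p,♯} for all 0 ≤ m < 4^ν and all scalars, then ‖Σ_{j=0}^{m} α_j h^{(ν+1)}_j‖_{p,♯} ≤ max{ c·‖r_0‖², ‖r_0‖² + 2(‖r_1‖² + ‖r_2‖² + ‖r_3‖²) } · ‖Σ_{j=0}^{4^{ν+1}−1} α_j h^{(ν+1)}_j‖_{p,♯} for all 0 ≤ m < 4^{ν+1} and all scalars. (L^p version of the Haar basis constant estimates.) -/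

import Mathlib

open Finset
open scoped ENNReal ComplexOrder Kronecker Matrix

noncomputable section

/-- Kronecker product of square complex matrices, realized on `Fin (m * n)`. -/
def kron {m n : ℕ} (x : Matrix (Fin m) (Fin m) ℂ) (y : Matrix (Fin n) (Fin n) ℂ) :
    Matrix (Fin (m * n)) (Fin (m * n)) ℂ :=
  Matrix.reindex finProdFinEquiv finProdFinEquiv (x ⊗ₖ y)

/-- The matrix `A₁ = diag(α, 1 - α)`. -/
def A1 (α : ℝ) : Matrix (Fin 2) (Fin 2) ℂ :=
  Matrix.diagonal ![(α : ℂ), ((1 - α : ℝ) : ℂ)]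

/-- The matrix `A₁^t = diag(α^t, (1 - α)^t)` (entrywise real power on the diagonal). -/
def A1t (α t : ℝ) : Matrix (Fin 2) (Fin 2) ℂ :=
  Matrix.diagonal ![((α ^ t : ℝ) : ℂ), (((1 - α) ^ t : ℝ) : ℂ)]

/-- `Amat α ν = A_ν`, the ν-fold Kronecker power of `diag(α, 1-α)`. -/
def Amat (α : ℝ) : (ν : ℕ) → Matrix (Fin (2 ^ ν)) (Fin (2 ^ ν)) ℂ
  | 0 => 1
  | ν + 1 => kron (Amat α ν) (A1 α)

/-- `Amatt α t ν = A_ν^t`, the ν-fold Kronecker power of `diag(α^t, (1-α)^t)`. -/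
def Amatt (α t : ℝ) : (ν : ℕ) → Matrix (Fin (2 ^ ν)) (Fin (2 ^ ν)) ℂ
  | 0 => 1
  | ν + 1 => kron (Amatt α t ν) (A1t α t)

/-- The state `ρ_ν(x) = Tr (x A_ν)` on `N_ν = M_{2^ν}(ℂ)`. -/
def rho (α : ℝ) (ν : ℕ) (x : Matrix (Fin (2 ^ ν)) (Fin (2 ^ ν)) ℂ) : ℂ :=
  (x * Amat α ν).trace

/-- The state `ρ_1(x) = Tr (x A_1)` on `M_2(ℂ)`. -/
def rho1 (α : ℝ) (x : Matrix (Fin 2) (Fin 2) ℂ) : ℂ :=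
  (x * A1 α).trace

/-- The Schatten `p`-norm `‖x‖_{C_p} = (Tr ((x^* x)^{p/2}))^{1/p}`, `1 ≤ p < ∞`,
computed through the eigenvalues of the positive semidefinite matrix `x^* x`. -/
def schatten {N : ℕ} (p : ℝ) (x : Matrix (Fin N) (Fin N) ℂ) : ℝ :=
  (∑ i, ((Matrix.posSemidef_conjTranspose_mul_self x).isHermitian.eigenvalues i) ^ (p / 2)) ^
    (1 / p)

/-- The operator norm `‖x‖ = ‖x‖_{C_∞}` of a complex matrix (acting on ℓ²). -/
def opNorm {N : ℕ} (x : Matrix (Fin N) (Fin N) ℂ) : ℝ :=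
  ‖Matrix.toEuclideanCLM (𝕜 := ℂ) x‖

/-- The left predual norm `‖x‖_♯ = ‖x A_ν‖_{C_1}` on `N_ν`. -/
def sharpNorm (α : ℝ) {ν : ℕ} (x : Matrix (Fin (2 ^ ν)) (Fin (2 ^ ν)) ℂ) : ℝ :=
  schatten 1 (x * Amat α ν)

/-- The right predual norm `‖x‖_♭ = ‖A_ν x‖_{C_1}` on `N_ν`. -/
def flatNorm (α : ℝ) {ν : ℕ} (x : Matrix (Fin (2 ^ ν)) (Fin (2 ^ ν)) ℂ) : ℝ :=
  schatten 1 (Amat α ν * x)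

/-- The left predual norm `‖x‖_♯ = ‖x A_1‖_{C_1}` on `M_2(ℂ)`. -/
def sharp2 (α : ℝ) (x : Matrix (Fin 2) (Fin 2) ℂ) : ℝ :=
  schatten 1 (x * A1 α)

/-- The right predual norm `‖x‖_♭ = ‖A_1 x‖_{C_1}` on `M_2(ℂ)`. -/
def flat2 (α : ℝ) (x : Matrix (Fin 2) (Fin 2) ℂ) : ℝ :=
  schatten 1 (A1 α * x)

/-- The left norm `‖x‖_{p,♯} = ‖x A_ν^{1/p}‖_{C_p}` on `N_ν`, `1 ≤ p ≤ ∞`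
(for `p = ∞` it is the operator norm). -/
def lpSharp (α : ℝ) (p : ℝ≥0∞) {ν : ℕ} (x : Matrix (Fin (2 ^ ν)) (Fin (2 ^ ν)) ℂ) : ℝ :=
  if p = ∞ then opNorm x else schatten p.toReal (x * Amatt α (1 / p.toReal) ν)

/-- The right norm `‖x‖_{p,♭} = ‖A_ν^{1/p} x‖_{C_p}` on `N_ν`, `1 ≤ p ≤ ∞`. -/
def lpFlat (α : ℝ) (p : ℝ≥0∞) {ν : ℕ} (x : Matrix (Fin (2 ^ ν)) (Fin (2 ^ ν)) ℂ) : ℝ :=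
  if p = ∞ then opNorm x else schatten p.toReal (Amatt α (1 / p.toReal) ν * x)

/-- The left norm `‖x‖_{p,♯} = ‖x A_1^{1/p}‖_{C_p}` on `M_2(ℂ)`. -/
def lp2Sharp (α : ℝ) (p : ℝ≥0∞) (x : Matrix (Fin 2) (Fin 2) ℂ) : ℝ :=
  if p = ∞ then opNorm x else schatten p.toReal (x * A1t α (1 / p.toReal))

/-- `shellNum r c` is `s(r+1, c+1) - 1`, the zero-based shell enumeration index of the
matrix unit `E_{r c}` (zero-based indices `r`, `c`): `s(r,c) = (c-1)² + r` if `r ≤ c`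
and `s(r,c) = r² - c + 1` if `r > c` (one-based). -/
def shellNum (r c : ℕ) : ℕ :=
  if r ≤ c then c * c + r else r * r + 2 * r - c

/-- `eUnit N m` is the `m`-th matrix unit `e_m` of `M_N(ℂ)` in the shell enumeration:
`e_{s(r,c) - 1} = E_{r c}`. -/
def eUnit (N m : ℕ) : Matrix (Fin N) (Fin N) ℂ :=
  Matrix.of fun r c => if shellNum (r : ℕ) (c : ℕ) = m then 1 else 0

/-- The left Haar system `h^{(ν)}_j` in `N_ν` built from `r_0, r_1, r_2, r_3 ∈ M_2(ℂ)`: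
`h^{(1)}_j = r_j`, and for `j = 4^ν q + k` (`0 ≤ q ≤ 3`, `0 ≤ k < 4^ν`),
`h^{(ν+1)}_j = h^{(ν)}_k ⊗ r_0` if `q = 0` and `h^{(ν+1)}_j = e^{(ν)}_k ⊗ r_q` if `q ≠ 0`. -/
def haar (r : ℕ → Matrix (Fin 2) (Fin 2) ℂ) :
    (ν : ℕ) → ℕ → Matrix (Fin (2 ^ ν)) (Fin (2 ^ ν)) ℂ
  | 0, _ => 1
  | 1, j => r (j % 4)
  | ν + 2, j =>
      if j / 4 ^ (ν + 1) = 0 then kron (haar r (ν + 1) j) (r 0)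
      else kron (eUnit (2 ^ (ν + 1)) (j % 4 ^ (ν + 1))) (r (j / 4 ^ (ν + 1) % 4))


section helpers
open scoped Matrix.Norms.L2Operator

lemma opNorm_eq {N : ℕ} (x : Matrix (Fin N) (Fin N) ℂ) : opNorm x = ‖x‖ := rfl

lemma conj_mul_norm (z : ℂ) : star z * z = ((‖z‖ ^ 2 : ℝ) : ℂ) := by
  have := Complex.conj_mul' z
  simpa using this

lemma col_sq_le {N : ℕ} (U : Matrix (Fin N) (Fin N) ℂ) (hU : ‖U‖ ≤ 1) (j : Fin N) :
    ∑ i, ‖U i j‖ ^ 2 ≤ 1 := by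
  have h := Matrix.l2_opNorm_mulVec U (EuclideanSpace.single j (1 : ℂ))
  have h2 : ‖WithLp.toLp 2 (U.mulVec (EuclideanSpace.single j (1 : ℂ)))‖ ≤ 1 := by
    refine h.trans ?_
    simpa using hU
  have h3 : ‖WithLp.toLp 2 (U.mulVec (EuclideanSpace.single j (1 : ℂ)))‖ ^ 2 ≤ 1 := by
    have := norm_nonneg (WithLp.toLp 2 (U.mulVec (EuclideanSpace.single j (1 : ℂ))))
    nlinarith
  rw [EuclideanSpace.norm_sq_eq] at h3
  simpa [Matrix.mulVec_single] using h3

lemma row_sq_le {N : ℕ} (U : Matrix (Fin N) (Fin N) ℂ) (hU : ‖U‖ ≤ 1) (i : Fin N) :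
    ∑ j, ‖U i j‖ ^ 2 ≤ 1 := by
  have := col_sq_le Uᴴ (by rwa [Matrix.l2_opNorm_conjTranspose]) i
  simpa using this

lemma sum_mul_le_one {ι : Type*} (s : Finset ι) (f g : ι → ℝ) (hf : ∑ i ∈ s, f i ^ 2 ≤ 1)
    (hg : ∑ i ∈ s, g i ^ 2 ≤ 1) : ∑ i ∈ s, f i * g i ≤ 1 := by
  have : ∑ i ∈ s, f i * g i ≤ ∑ i ∈ s, (f i ^ 2 + g i ^ 2) / 2 :=
    Finset.sum_le_sum fun i _ => by nlinarith [sq_nonneg (f i - g i)]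
  rw [← Finset.sum_div, Finset.sum_add_distrib] at this
  linarith

/-- Jensen / Hoelder with sub-probability weights. -/
lemma jensen_sub {ι : Type*} (s : Finset ι) {p : ℝ} (hp : 1 ≤ p) (w f : ι → ℝ)
    (hw : ∀ i, 0 ≤ w i) (hf : ∀ i, 0 ≤ f i) (h1 : ∑ i ∈ s, w i ≤ 1) :
    (∑ i ∈ s, w i * f i) ^ p ≤ ∑ i ∈ s, w i * f i ^ p := by
  have hp0 : 0 < p := by linarith
  have h := Real.inner_le_weight_mul_Lp_of_nonneg s hp w f hw hf
  have hw0 : 0 ≤ ∑ i ∈ s, w i := Finset.sum_nonneg fun i _ => hw i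
  have hS : 0 ≤ ∑ i ∈ s, w i * f i ^ p :=
    Finset.sum_nonneg fun i _ => mul_nonneg (hw i) (Real.rpow_nonneg (hf i) _)
  have h2 : (∑ i ∈ s, w i) ^ (1 - p⁻¹) ≤ 1 := by
    apply Real.rpow_le_one hw0 h1
    have : p⁻¹ ≤ 1 := inv_le_one_of_one_le₀ hp
    linarith
  have h3 : ∑ i ∈ s, w i * f i ≤ (∑ i ∈ s, w i * f i ^ p) ^ p⁻¹ :=
    h.trans (mul_le_of_le_one_left (Real.rpow_nonneg hS _) h2)
  calc (∑ i ∈ s, w i * f i) ^ p ≤ ((∑ i ∈ s, w i * f i ^ p) ^ p⁻¹) ^ p :=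
        Real.rpow_le_rpow (Finset.sum_nonneg fun i _ => mul_nonneg (hw i) (hf i)) h3 hp0.le
    _ = _ := Real.rpow_inv_rpow hS hp0.ne'

lemma diag_bound {N : ℕ} {p : ℝ} (hp : 1 ≤ p) (U V : Matrix (Fin N) (Fin N) ℂ)
    (hU : ‖U‖ ≤ 1) (hV : ‖V‖ ≤ 1) (d : Fin N → ℝ) (hd : ∀ k, 0 ≤ d k) :
    ∑ i, ‖(U * Matrix.diagonal (fun k => (d k : ℂ)) * V) i i‖ ^ p ≤ ∑ k, d k ^ p := by
  have hp0 : 0 < p := by linarith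
  have h1 : ∀ i, ‖(U * Matrix.diagonal (fun k => (d k : ℂ)) * V) i i‖ ^ p ≤
      ∑ k, (‖U i k‖ * ‖V k i‖) * d k ^ p := by
    intro i
    refine le_trans (Real.rpow_le_rpow (norm_nonneg _) ?_ hp0.le)
      (jensen_sub Finset.univ hp (fun k => ‖U i k‖ * ‖V k i‖) d (fun k => by positivity) hd
        (sum_mul_le_one _ _ _ (row_sq_le U hU i) (col_sq_le V hV i)))
    rw [Matrix.mul_apply]
    refine (norm_sum_le _ _).trans (Finset.sum_le_sum fun k _ => ?_)
    rw [Matrix.mul_diagonal, norm_mul, norm_mul, Complex.norm_real, Real.norm_of_nonneg (hd k)]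
    exact le_of_eq (by ring)
  refine (Finset.sum_le_sum fun i _ => h1 i).trans ?_
  rw [Finset.sum_comm]
  refine Finset.sum_le_sum fun k _ => ?_
  rw [← Finset.sum_mul]
  refine mul_le_of_le_one_left (Real.rpow_nonneg (hd k) _) ?_
  exact sum_mul_le_one _ _ _ (col_sq_le U hU k) (row_sq_le V hV k)

lemma norm_le_one_of_star_mul {N : ℕ} (U : Matrix (Fin N) (Fin N) ℂ) (h : ‖Uᴴ * U‖ ≤ 1) :
    ‖U‖ ≤ 1 := by
  rw [Matrix.l2_opNorm_conjTranspose_mul_self] at h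
  nlinarith [norm_nonneg U]

lemma norm_diagonal_le_one {N : ℕ} (v : Fin N → ℂ) (h : ∀ i, ‖v i‖ ≤ 1) :
    ‖(Matrix.diagonal v : Matrix (Fin N) (Fin N) ℂ)‖ ≤ 1 := by
  rw [Matrix.l2_opNorm_diagonal]
  exact (pi_norm_le_iff_of_nonneg zero_le_one).2 h

lemma norm_one_le {N : ℕ} : ‖(1 : Matrix (Fin N) (Fin N) ℂ)‖ ≤ 1 := by
  rw [← Matrix.diagonal_one]
  exact norm_diagonal_le_one _ (by simp)

lemma norm_mul_le_one {N : ℕ} (U V : Matrix (Fin N) (Fin N) ℂ)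
    (hU : ‖U‖ ≤ 1) (hV : ‖V‖ ≤ 1) : ‖U * V‖ ≤ 1 := by
  refine (norm_mul_le _ _).trans ?_
  nlinarith [norm_nonneg U, norm_nonneg V]

/-- Singular value decomposition together with the value of the Schatten norm. -/
lemma svd {N : ℕ} (x : Matrix (Fin N) (Fin N) ℂ) :
    ∃ (F W : Matrix (Fin N) (Fin N) ℂ) (d : Fin N → ℝ), ‖F‖ ≤ 1 ∧ ‖W‖ ≤ 1 ∧
      ‖Fᴴ‖ ≤ 1 ∧ ‖Wᴴ‖ ≤ 1 ∧ (∀ k, 0 ≤ d k) ∧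
      x = F * Matrix.diagonal (fun k => (d k : ℂ)) * Wᴴ ∧
      Fᴴ * x * W = Matrix.diagonal (fun k => (d k : ℂ)) ∧
      ∀ p : ℝ, schatten p x = (∑ k, d k ^ p) ^ (1 / p) := by
  set hps := Matrix.posSemidef_conjTranspose_mul_self x with hpsdef
  set hA := hps.isHermitian with hAdef
  set lam := hA.eigenvalues with hlam
  have hl0 : ∀ k, 0 ≤ lam k := fun k => hps.eigenvalues_nonneg k
  set W : Matrix (Fin N) (Fin N) ℂ := (hA.eigenvectorUnitary : Matrix (Fin N) (Fin N) ℂ) with hW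
  have hWW : Wᴴ * W = 1 := Unitary.coe_star_mul_self hA.eigenvectorUnitary
  have hWW' : W * Wᴴ = 1 := Unitary.coe_mul_star_self hA.eigenvectorUnitary
  have hsp : xᴴ * x = W * Matrix.diagonal (fun k => (lam k : ℂ)) * Wᴴ := by
    have := hA.spectral_theorem
    rw [Unitary.conjStarAlgAut_apply] at this
    exact this
  have hM : (x * W)ᴴ * (x * W) = Matrix.diagonal (fun k => (lam k : ℂ)) := by
    rw [Matrix.conjTranspose_mul]
    calc Wᴴ * xᴴ * (x * W) = Wᴴ * (xᴴ * x) * W := by simp only [Matrix.mul_assoc]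
      _ = (Wᴴ * W) * Matrix.diagonal (fun k => (lam k : ℂ)) * (Wᴴ * W) := by
          rw [hsp]; simp only [Matrix.mul_assoc]
      _ = _ := by rw [hWW]; simp
  set d : Fin N → ℝ := fun k => Real.sqrt (lam k) with hd
  have hdd : ∀ k, d k * d k = lam k := fun k => Real.mul_self_sqrt (hl0 k)
  set Di : Matrix (Fin N) (Fin N) ℂ := Matrix.diagonal (fun k => (((d k)⁻¹ : ℝ) : ℂ)) with hDi
  have hDiH : Diᴴ = Di := by
    rw [hDi, Matrix.diagonal_conjTranspose]
    congr 1; ext k; simp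
  set F := x * W * Di with hF
  have hFx : Fᴴ * (x * W) = Matrix.diagonal (fun k => (d k : ℂ)) := by
    rw [hF, Matrix.conjTranspose_mul, hDiH, Matrix.mul_assoc, hM, hDi, Matrix.diagonal_mul_diagonal]
    congr 1; ext k
    rw [← Complex.ofReal_mul, ← hdd k]
    congr 1
    by_cases h : d k = 0
    · simp [h]
    · field_simp
  have hF1 : ‖F‖ ≤ 1 := by
    apply norm_le_one_of_star_mul
    have : Fᴴ * F = Fᴴ * (x * W) * Di := by rw [hF]; simp only [Matrix.mul_assoc]
    rw [this, hFx, hDi, Matrix.diagonal_mul_diagonal]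
    apply norm_diagonal_le_one
    intro k
    rw [← Complex.ofReal_mul, Complex.norm_real]
    by_cases h : d k = 0
    · simp [h]
    · rw [mul_inv_cancel₀ h]; simp
  have hW1 : ‖W‖ ≤ 1 := by
    apply norm_le_one_of_star_mul
    rw [hWW]; exact norm_one_le
  have hFD : F * Matrix.diagonal (fun k => (d k : ℂ)) = x * W := by
    ext i k
    rw [hF, hDi, Matrix.mul_assoc, Matrix.diagonal_mul_diagonal, Matrix.mul_diagonal,
      ← Complex.ofReal_mul]
    by_cases h : d k = 0
    · have hl : lam k = 0 := by rw [← hdd k, h]; simp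
      have h2 : ((x * W)ᴴ * (x * W)) k k = 0 := by rw [hM]; simp [hl]
      have h3 : ∑ i, ‖(x * W) i k‖ ^ 2 = 0 := by
        rw [Matrix.mul_apply] at h2
        have h4 : ((∑ i, ‖(x * W) i k‖ ^ 2 : ℝ) : ℂ) = 0 := by
          rw [← h2, Complex.ofReal_sum]
          refine Finset.sum_congr rfl fun i _ => ?_
          rw [← conj_mul_norm, Matrix.conjTranspose_apply]
        exact_mod_cast h4
      have h5 := (Finset.sum_eq_zero_iff_of_nonneg (fun i _ => by positivity)).1 h3 i
        (Finset.mem_univ i)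
      have h6 : (x * W) i k = 0 := by simpa using h5
      rw [h6]; simp
    · rw [inv_mul_cancel₀ h]; simp
  refine ⟨F, W, d, hF1, hW1, by rwa [Matrix.l2_opNorm_conjTranspose],
    by rwa [Matrix.l2_opNorm_conjTranspose], fun k => Real.sqrt_nonneg _, ?_, ?_, ?_⟩
  · rw [hFD, Matrix.mul_assoc, hWW', Matrix.mul_one]
  · rw [Matrix.mul_assoc, hFx]
  · intro p
    unfold schatten
    congr 1
    refine Finset.sum_congr rfl fun k _ => ?_
    change lam k ^ (p / 2) = (Real.sqrt (lam k)) ^ p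
    rw [Real.sqrt_eq_rpow, ← Real.rpow_mul (hl0 k)]
    congr 1; ring

lemma schatten_nonneg {N : ℕ} (p : ℝ) (x : Matrix (Fin N) (Fin N) ℂ) : 0 ≤ schatten p x := by
  obtain ⟨F, W, d, -, -, -, -, hd, -, -, hs⟩ := svd x
  rw [hs]
  exact Real.rpow_nonneg (Finset.sum_nonneg fun k _ => Real.rpow_nonneg (hd k) _) _

lemma rpow_one_div_rpow {p a : ℝ} (hp : 1 ≤ p) (ha : 0 ≤ a) : (a ^ (1 / p)) ^ p = a := by
  rw [one_div]; exact Real.rpow_inv_rpow ha (by linarith)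

lemma rpow_rpow_one_div {p a : ℝ} (hp : 1 ≤ p) (ha : 0 ≤ a) : (a ^ p) ^ (1 / p) = a := by
  rw [one_div]; exact Real.rpow_rpow_inv ha (by linarith)

lemma le_of_rpow {p a b : ℝ} (hp : 1 ≤ p) (hb : 0 ≤ b) (h : a ^ p ≤ b ^ p) : a ≤ b := by
  by_contra hc
  push Not at hc
  exact absurd h (not_le.2 (Real.rpow_lt_rpow hb hc (by linarith)))

lemma schatten_var {N : ℕ} {p : ℝ} (hp : 1 ≤ p) (x U V : Matrix (Fin N) (Fin N) ℂ)
    (hU : ‖U‖ ≤ 1) (hV : ‖V‖ ≤ 1) :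
    ∑ i, ‖(U * x * V) i i‖ ^ p ≤ schatten p x ^ p := by
  obtain ⟨F, W, d, hF, hW, hF', hW', hd, hx, hx', hs⟩ := svd x
  rw [hs, rpow_one_div_rpow hp (Finset.sum_nonneg fun k _ => Real.rpow_nonneg (hd k) _)]
  have := diag_bound hp (U * F) (Wᴴ * V) (norm_mul_le_one _ _ hU hF) (norm_mul_le_one _ _ hW' hV)
    d hd
  have e : U * x * V = U * F * Matrix.diagonal (fun k => (d k : ℂ)) * (Wᴴ * V) := by
    conv_lhs => rw [hx]
    simp only [Matrix.mul_assoc]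
  rw [e]; exact this

lemma schatten_att {N : ℕ} {p : ℝ} (hp : 1 ≤ p) (x : Matrix (Fin N) (Fin N) ℂ) :
    ∃ U V : Matrix (Fin N) (Fin N) ℂ, ‖U‖ ≤ 1 ∧ ‖V‖ ≤ 1 ∧
      schatten p x ^ p = ∑ i, ‖(U * x * V) i i‖ ^ p := by
  obtain ⟨F, W, d, hF, hW, hF', hW', hd, hx, hx', hs⟩ := svd x
  refine ⟨Fᴴ, W, hF', hW, ?_⟩
  rw [hs, rpow_one_div_rpow hp (Finset.sum_nonneg fun k _ => Real.rpow_nonneg (hd k) _), hx']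
  refine Finset.sum_congr rfl fun k _ => ?_
  rw [Matrix.diagonal_apply_eq, Complex.norm_real, Real.norm_of_nonneg (hd k)]

lemma schatten_le_of {N : ℕ} {p : ℝ} (hp : 1 ≤ p) (x : Matrix (Fin N) (Fin N) ℂ) (t : ℝ)
    (ht : 0 ≤ t) (h : ∀ U V : Matrix (Fin N) (Fin N) ℂ, ‖U‖ ≤ 1 → ‖V‖ ≤ 1 →
      ∑ i, ‖(U * x * V) i i‖ ^ p ≤ t ^ p) : schatten p x ≤ t := by
  obtain ⟨U, V, hU, hV, e⟩ := schatten_att hp x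
  exact le_of_rpow hp ht (e ▸ h U V hU hV)

lemma schatten_add_le {N : ℕ} {p : ℝ} (hp : 1 ≤ p) (x y : Matrix (Fin N) (Fin N) ℂ) :
    schatten p (x + y) ≤ schatten p x + schatten p y := by
  have hp0 : 0 ≤ p := by linarith
  obtain ⟨U, V, hU, hV, e⟩ := schatten_att hp (x + y)
  have hb : ∀ z : Matrix (Fin N) (Fin N) ℂ, 
      (∑ i, ‖(U * z * V) i i‖ ^ p) ^ (1 / p) ≤ schatten p z := fun z => by
    rw [← rpow_rpow_one_div hp (schatten_nonneg p z)]
    exact Real.rpow_le_rpow (by positivity) (schatten_var hp z U V hU hV) (by positivity)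
  calc schatten p (x + y) = (∑ i, ‖(U * (x + y) * V) i i‖ ^ p) ^ (1 / p) := by
        rw [← e, rpow_rpow_one_div hp (schatten_nonneg _ _)]
    _ ≤ (∑ i, (‖(U * x * V) i i‖ + ‖(U * y * V) i i‖) ^ p) ^ (1 / p) := by
        refine Real.rpow_le_rpow (by positivity) (Finset.sum_le_sum fun i _ => 
          Real.rpow_le_rpow (norm_nonneg _) ?_ hp0) (by positivity)
        rw [Matrix.mul_add, Matrix.add_mul, Matrix.add_apply]
        exact norm_add_le _ _
    _ ≤ (∑ i, ‖(U * x * V) i i‖ ^ p) ^ (1 / p) + (∑ i, ‖(U * y * V) i i‖ ^ p) ^ (1 / p) :=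
        Real.Lp_add_le_of_nonneg _ hp (fun i _ => norm_nonneg _) (fun i _ => norm_nonneg _)
    _ ≤ _ := add_le_add (hb x) (hb y)

lemma schatten_contr {N : ℕ} {p : ℝ} (hp : 1 ≤ p) (x a b : Matrix (Fin N) (Fin N) ℂ)
    (ha : ‖a‖ ≤ 1) (hb : ‖b‖ ≤ 1) : schatten p (a * x * b) ≤ schatten p x := by
  refine schatten_le_of hp _ _ (schatten_nonneg _ _) fun U V hU hV => ?_
  have := schatten_var hp x (U * a) (b * V) (norm_mul_le_one _ _ hU ha) (norm_mul_le_one _ _ hb hV)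
  simpa only [Matrix.mul_assoc] using this

lemma schatten_smul {N : ℕ} {p : ℝ} (hp : 1 ≤ p) (x : Matrix (Fin N) (Fin N) ℂ) (c : ℂ) :
    schatten p (c • x) ≤ ‖c‖ * schatten p x := by
  refine schatten_le_of hp _ _ (mul_nonneg (norm_nonneg _) (schatten_nonneg _ _))
    fun U V hU hV => ?_
  have := schatten_var hp x U V hU hV
  rw [Real.mul_rpow (norm_nonneg _) (schatten_nonneg _ _)]
  refine le_trans (le_of_eq ?_) (mul_le_mul_of_nonneg_left this
    (Real.rpow_nonneg (norm_nonneg c) p))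
  rw [Finset.mul_sum]
  refine Finset.sum_congr rfl fun i _ => ?_
  rw [Matrix.mul_smul, Matrix.smul_mul, Matrix.smul_apply, norm_smul,
    Real.mul_rpow (norm_nonneg _) (norm_nonneg _)]

lemma schatten_mul_left {N : ℕ} {p : ℝ} (hp : 1 ≤ p) (x a : Matrix (Fin N) (Fin N) ℂ) :
    schatten p (a * x) ≤ ‖a‖ * schatten p x := by
  have h1 : ‖(((‖a‖⁻¹ : ℝ) : ℂ) • a)‖ ≤ 1 := by
    rw [norm_smul, Complex.norm_real, norm_inv, norm_norm]
    exact inv_mul_le_one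
  have h2 : a * x = ((‖a‖ : ℝ) : ℂ) • ((((‖a‖⁻¹ : ℝ) : ℂ) • a) * x * 1) := by
    by_cases h : ‖a‖ = 0
    · have : a = 0 := norm_eq_zero.1 h
      simp [this]
    · rw [Matrix.mul_one, Matrix.smul_mul, smul_smul, ← Complex.ofReal_mul, mul_inv_cancel₀ h]
      simp
  conv_lhs => rw [h2]
  refine (schatten_smul hp _ _).trans ?_
  rw [Complex.norm_real, norm_norm]
  exact mul_le_mul_of_nonneg_left (schatten_contr hp x _ 1 h1 norm_one_le) (norm_nonneg _)

lemma schatten_le_diag {N : ℕ} {p : ℝ} (hp : 1 ≤ p) (U V : Matrix (Fin N) (Fin N) ℂ)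
    (hU : ‖U‖ ≤ 1) (hV : ‖V‖ ≤ 1) (d : Fin N → ℝ) (hd : ∀ k, 0 ≤ d k) :
    schatten p (U * Matrix.diagonal (fun k => (d k : ℂ)) * V) ≤ (∑ k, d k ^ p) ^ (1 / p) := by
  have h0 : 0 ≤ ∑ k, d k ^ p := Finset.sum_nonneg fun k _ => Real.rpow_nonneg (hd k) _
  refine schatten_le_of hp _ _ (Real.rpow_nonneg h0 _) fun U' V' hU' hV' => ?_
  rw [rpow_one_div_rpow hp h0]
  have := diag_bound hp (U' * U) (V * V') (norm_mul_le_one _ _ hU' hU)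
    (norm_mul_le_one _ _ hV hV') d hd
  simpa only [Matrix.mul_assoc] using this

end helpers

section helpers2
open scoped Matrix.Norms.L2Operator

lemma kron_apply' {m n : ℕ} (x : Matrix (Fin m) (Fin m) ℂ) (y : Matrix (Fin n) (Fin n) ℂ)
    (i j : Fin m) (k l : Fin n) :
    kron x y (finProdFinEquiv (i, k)) (finProdFinEquiv (j, l)) = x i j * y k l := by
  simp [kron]

lemma ext_prod {m n : ℕ} {x y : Matrix (Fin (m * n)) (Fin (m * n)) ℂ}
    (h : ∀ i j k l, x (finProdFinEquiv (i, k)) (finProdFinEquiv (j, l)) =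
      y (finProdFinEquiv (i, k)) (finProdFinEquiv (j, l))) : x = y := by
  ext a b
  obtain ⟨⟨i, k⟩, rfl⟩ := finProdFinEquiv.surjective a
  obtain ⟨⟨j, l⟩, rfl⟩ := finProdFinEquiv.surjective b
  exact h i j k l

lemma sum_fin_prod {m n : ℕ} {M : Type*} [AddCommMonoid M] (f : Fin (m * n) → M) :
    ∑ a, f a = ∑ i : Fin m, ∑ k : Fin n, f (finProdFinEquiv (i, k)) := by
  rw [← finProdFinEquiv.sum_comp, Fintype.sum_prod_type]

lemma kron_mul {m n : ℕ} (x x' : Matrix (Fin m) (Fin m) ℂ) (y y' : Matrix (Fin n) (Fin n) ℂ) :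
    kron x y * kron x' y' = kron (x * x') (y * y') := by
  apply ext_prod
  intro i j k l
  rw [Matrix.mul_apply, sum_fin_prod, kron_apply', Matrix.mul_apply, Matrix.mul_apply,
    Finset.sum_mul_sum]
  refine Finset.sum_congr rfl fun a _ => Finset.sum_congr rfl fun b _ => ?_
  rw [kron_apply', kron_apply']; ring

lemma kron_add_left {m n : ℕ} (x x' : Matrix (Fin m) (Fin m) ℂ) (y : Matrix (Fin n) (Fin n) ℂ) :
    kron (x + x') y = kron x y + kron x' y := by
  apply ext_prod
  intro i j k l
  rw [Matrix.add_apply, kron_apply', kron_apply', kron_apply', Matrix.add_apply]; ring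

lemma kron_add_right {m n : ℕ} (x : Matrix (Fin m) (Fin m) ℂ) (y y' : Matrix (Fin n) (Fin n) ℂ) :
    kron x (y + y') = kron x y + kron x y' := by
  apply ext_prod
  intro i j k l
  rw [Matrix.add_apply, kron_apply', kron_apply', kron_apply', Matrix.add_apply]; ring

lemma kron_smul_left {m n : ℕ} (c : ℂ) (x : Matrix (Fin m) (Fin m) ℂ)
    (y : Matrix (Fin n) (Fin n) ℂ) : kron (c • x) y = c • kron x y := by
  apply ext_prod
  intro i j k l
  rw [Matrix.smul_apply, kron_apply', kron_apply', Matrix.smul_apply, smul_eq_mul, smul_eq_mul]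
  ring

lemma kron_smul_right {m n : ℕ} (c : ℂ) (x : Matrix (Fin m) (Fin m) ℂ)
    (y : Matrix (Fin n) (Fin n) ℂ) : kron x (c • y) = c • kron x y := by
  apply ext_prod
  intro i j k l
  rw [Matrix.smul_apply, kron_apply', kron_apply', Matrix.smul_apply, smul_eq_mul, smul_eq_mul]
  ring

lemma kron_zero_left {m n : ℕ} (y : Matrix (Fin n) (Fin n) ℂ) :
    kron (0 : Matrix (Fin m) (Fin m) ℂ) y = 0 := by
  apply ext_prod
  intro i j k l
  rw [kron_apply']; simp

lemma kron_zero_right {m n : ℕ} (x : Matrix (Fin m) (Fin m) ℂ) :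
    kron x (0 : Matrix (Fin n) (Fin n) ℂ) = 0 := by
  apply ext_prod
  intro i j k l
  rw [kron_apply']; simp

lemma kron_star {m n : ℕ} (x : Matrix (Fin m) (Fin m) ℂ) (y : Matrix (Fin n) (Fin n) ℂ) :
    kron xᴴ yᴴ = (kron x y)ᴴ := by
  apply ext_prod
  intro i j k l
  simp only [kron_apply', Matrix.conjTranspose_apply]; simp

lemma kron_diag {m n : ℕ} (v : Fin m → ℂ) (w : Fin n → ℂ) :
    kron (Matrix.diagonal v) (Matrix.diagonal w) =
      Matrix.diagonal (fun a => v (finProdFinEquiv.symm a).1 * w (finProdFinEquiv.symm a).2) := by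
  apply ext_prod
  intro i j k l
  rw [kron_apply']
  simp only [Matrix.diagonal_apply, EmbeddingLike.apply_eq_iff_eq, Prod.mk.injEq,
    Equiv.symm_apply_apply]
  by_cases h1 : i = j <;> by_cases h2 : k = l <;> simp [h1, h2]

/-- `x ↦ x ⊗ 1` as a star homomorphism. -/
def kronL (m n : ℕ) : Matrix (Fin m) (Fin m) ℂ →⋆ₙₐ[ℂ] Matrix (Fin (m * n)) (Fin (m * n)) ℂ where
  toFun x := kron x (1 : Matrix (Fin n) (Fin n) ℂ)
  map_smul' c x := kron_smul_left c x _
  map_zero' := kron_zero_left _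
  map_add' x y := kron_add_left x y _
  map_mul' x y := by rw [kron_mul, Matrix.mul_one]
  map_star' x := by
    rw [Matrix.star_eq_conjTranspose, Matrix.star_eq_conjTranspose, ← kron_star,
      Matrix.conjTranspose_one]

/-- `y ↦ 1 ⊗ y` as a star homomorphism. -/
def kronR (m n : ℕ) : Matrix (Fin n) (Fin n) ℂ →⋆ₙₐ[ℂ] Matrix (Fin (m * n)) (Fin (m * n)) ℂ where
  toFun y := kron (1 : Matrix (Fin m) (Fin m) ℂ) y
  map_smul' c x := kron_smul_right c _ x
  map_zero' := kron_zero_right _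
  map_add' x y := kron_add_right _ x y
  map_mul' x y := by rw [kron_mul, Matrix.mul_one]
  map_star' x := by
    rw [Matrix.star_eq_conjTranspose, Matrix.star_eq_conjTranspose, ← kron_star,
      Matrix.conjTranspose_one]

lemma norm_kronL {m n : ℕ} (x : Matrix (Fin m) (Fin m) ℂ) :
    ‖kron x (1 : Matrix (Fin n) (Fin n) ℂ)‖ ≤ ‖x‖ :=
  NonUnitalStarAlgHom.norm_apply_le (kronL m n) x

lemma norm_kronR {m n : ℕ} (y : Matrix (Fin n) (Fin n) ℂ) :
    ‖kron (1 : Matrix (Fin m) (Fin m) ℂ) y‖ ≤ ‖y‖ :=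
  NonUnitalStarAlgHom.norm_apply_le (kronR m n) y

/-- weights -/
def wt (α : ℝ) : Fin 2 → ℝ := ![α, 1 - α]

lemma wt_pos {α : ℝ} (h0 : 0 < α) (h1 : α ≤ 1 / 2) (k : Fin 2) : 0 < wt α k := by
  fin_cases k
  · simpa [wt] using h0
  · simp [wt]; linarith

lemma wt_sum (α : ℝ) : ∑ k, wt α k = 1 := by simp [wt]

lemma A1_eq (α : ℝ) : A1 α = Matrix.diagonal (fun k => (wt α k : ℂ)) := by
  unfold A1; congr 1; ext k; fin_cases k <;> simp [wt]

lemma A1t_eq (α t : ℝ) : A1t α t = Matrix.diagonal (fun k => ((wt α k ^ t : ℝ) : ℂ)) := by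
  unfold A1t; congr 1; ext k; fin_cases k <;> simp [wt]

lemma Amatt_diag (α t : ℝ) (ν : ℕ) : ∃ v, Amatt α t ν = Matrix.diagonal v := by
  induction ν with
  | zero => exact ⟨fun _ => 1, by simp [Amatt]⟩
  | succ ν ih =>
    obtain ⟨v, hv⟩ := ih
    have h := kron_diag v (fun k => ((wt α k ^ t : ℝ) : ℂ))
    rw [← hv, ← A1t_eq] at h
    exact ⟨_, h⟩

/-- diagonal block -/
def blk {m : ℕ} (k : Fin 2) (x : Matrix (Fin (m * 2)) (Fin (m * 2)) ℂ) :
    Matrix (Fin m) (Fin m) ℂ :=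
  Matrix.of fun i j => x (finProdFinEquiv (i, k)) (finProdFinEquiv (j, k))

/-- conditional expectation -/
def cE {m : ℕ} (α : ℝ) (x : Matrix (Fin (m * 2)) (Fin (m * 2)) ℂ) : Matrix (Fin m) (Fin m) ℂ :=
  ∑ k, (wt α k : ℂ) • blk k x

lemma blk_mul_kron {m : ℕ} (k : Fin 2) (x : Matrix (Fin (m * 2)) (Fin (m * 2)) ℂ)
    (V : Matrix (Fin m) (Fin m) ℂ) (δ : Fin 2 → ℂ) :
    blk k (x * kron V (Matrix.diagonal δ)) = δ k • (blk k x * V) := by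
  ext i j
  simp only [blk, Matrix.of_apply, Matrix.smul_apply, Matrix.mul_apply, sum_fin_prod, kron_apply',
    smul_eq_mul, Finset.mul_sum]
  refine Finset.sum_congr rfl fun a _ => ?_
  rw [Finset.sum_eq_single k]
  · simp; ring
  · intro b _ hb; simp [hb]
  · simp

lemma blk_kron_mul {m : ℕ} (k : Fin 2) (x : Matrix (Fin (m * 2)) (Fin (m * 2)) ℂ)
    (U : Matrix (Fin m) (Fin m) ℂ) :
    blk k (kron U 1 * x) = U * blk k x := by
  ext i j
  simp only [blk, Matrix.of_apply, Matrix.mul_apply, sum_fin_prod, kron_apply']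
  refine Finset.sum_congr rfl fun a _ => ?_
  rw [Finset.sum_eq_single k]
  · simp
  · intro b _ hb; simp [Ne.symm hb]
  · simp

lemma cE_kron {m : ℕ} (α : ℝ) (y : Matrix (Fin m) (Fin m) ℂ) (s : Matrix (Fin 2) (Fin 2) ℂ) :
    cE α (kron y s) = rho1 α s • y := by
  ext i j
  simp only [cE, rho1, A1_eq, Matrix.sum_apply, Matrix.smul_apply, blk, Matrix.of_apply,
    kron_apply', Matrix.trace, Matrix.diag_apply, Matrix.mul_diagonal, smul_eq_mul, Finset.sum_mul]
  exact Finset.sum_congr rfl fun k _ => by ring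

lemma cE_add {m : ℕ} (α : ℝ) (x y : Matrix (Fin (m * 2)) (Fin (m * 2)) ℂ) :
    cE α (x + y) = cE α x + cE α y := by
  ext i j
  simp [cE, blk]; ring

lemma cE_schatten {m : ℕ} {p : ℝ} (hp : 1 ≤ p) {α : ℝ} (h0 : 0 < α) (h1 : α ≤ 1 / 2)
    (x : Matrix (Fin (m * 2)) (Fin (m * 2)) ℂ) (B : Matrix (Fin m) (Fin m) ℂ) :
    schatten p (cE α x * B) ≤ schatten p (x * kron B (A1t α (1 / p))) := by
  have hp0 : 0 ≤ p := by linarith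
  refine schatten_le_of hp _ _ (schatten_nonneg _ _) fun U V hU hV => ?_
  have hv := schatten_var hp (x * kron B (A1t α (1 / p))) (kron U 1) (kron V 1)
    ((norm_kronL U).trans hU) ((norm_kronL V).trans hV)
  refine le_trans ?_ hv
  rw [sum_fin_prod]
  refine Finset.sum_le_sum fun i _ => ?_
  have e : ∀ k : Fin 2, ‖(kron U 1 * (x * kron B (A1t α (1 / p))) * kron V 1 :
        Matrix (Fin (m * 2)) (Fin (m * 2)) ℂ)
      (finProdFinEquiv (i, k)) (finProdFinEquiv (i, k))‖ ^ p =
      wt α k * ‖(U * (blk k x * B) * V) i i‖ ^ p := by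
    intro k
    have : blk k (kron U 1 * (x * kron B (A1t α (1 / p))) * kron V 1) =
        ((wt α k ^ (1 / p) : ℝ) : ℂ) • (U * (blk k x * B) * V) := by
      rw [← Matrix.diagonal_one, blk_mul_kron, Matrix.diagonal_one, blk_kron_mul, A1t_eq,
        blk_mul_kron]
      simp
    have h2 : (kron U 1 * (x * kron B (A1t α (1 / p))) * kron V 1 :
        Matrix (Fin (m * 2)) (Fin (m * 2)) ℂ)
      (finProdFinEquiv (i, k)) (finProdFinEquiv (i, k)) =
        ((wt α k ^ (1 / p) : ℝ) : ℂ) * (U * (blk k x * B) * V) i i := by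
      have := congrFun (congrFun this i) i
      simpa [blk] using this
    have hw := (wt_pos h0 h1 k).le
    rw [h2, norm_mul, Real.mul_rpow (norm_nonneg _) (norm_nonneg _), Complex.norm_real,
      Real.norm_of_nonneg (Real.rpow_nonneg hw _), rpow_one_div_rpow hp hw]
  simp only [e]
  refine le_trans (Real.rpow_le_rpow (norm_nonneg _) ?_ hp0)
    (jensen_sub Finset.univ hp (wt α) (fun k => ‖(U * (blk k x * B) * V) i i‖)
      (fun k => (wt_pos h0 h1 k).le) (fun k => norm_nonneg _) (wt_sum α).le)
  have e2 : (U * (cE α x * B) * V) i i = ∑ k, (wt α k : ℂ) * (U * (blk k x * B) * V) i i := by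
    simp only [cE, Matrix.sum_mul, Matrix.mul_sum, Matrix.sum_apply, Matrix.smul_mul,
      Matrix.mul_smul, Matrix.smul_apply, smul_eq_mul]
  rw [e2]
  refine (norm_sum_le _ _).trans (Finset.sum_le_sum fun k _ => ?_)
  rw [norm_mul, Complex.norm_real, Real.norm_of_nonneg (wt_pos h0 h1 k).le]

lemma norm_blk {m : ℕ} (k : Fin 2) (x : Matrix (Fin (m * 2)) (Fin (m * 2)) ℂ) :
    ‖blk k x‖ ≤ ‖x‖ := by
  let V : Matrix (Fin (m * 2)) (Fin m) ℂ := Matrix.of fun a j => if a = finProdFinEquiv (j, k)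
    then 1 else 0
  have hV : Vᴴ * V = 1 := by
    ext i j
    simp [V, Matrix.mul_apply, Matrix.one_apply, eq_comm]
  have hn : ‖V‖ ≤ 1 := by
    have h := Matrix.l2_opNorm_conjTranspose_mul_self V
    rw [hV] at h
    have : ‖(1 : Matrix (Fin m) (Fin m) ℂ)‖ ≤ 1 := norm_one_le
    nlinarith [norm_nonneg V]
  have e : blk k x = Vᴴ * x * V := by
    ext i j
    simp [V, Matrix.mul_apply, blk]
  rw [e]
  have h1 := Matrix.l2_opNorm_mul (Vᴴ * x) V
  have h2 := Matrix.l2_opNorm_mul Vᴴ x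
  rw [Matrix.l2_opNorm_conjTranspose] at h2
  have h3 : ‖Vᴴ * x‖ ≤ ‖x‖ := h2.trans (mul_le_of_le_one_left (norm_nonneg _) hn)
  exact h1.trans ((mul_le_of_le_one_right (norm_nonneg _) hn).trans h3)

lemma norm_cE {m : ℕ} {α : ℝ} (h0 : 0 < α) (h1 : α ≤ 1 / 2)
    (x : Matrix (Fin (m * 2)) (Fin (m * 2)) ℂ) : ‖cE α x‖ ≤ ‖x‖ := by
  refine (norm_sum_le _ _).trans ?_
  calc ∑ k, ‖(wt α k : ℂ) • blk k x‖ ≤ ∑ k, wt α k * ‖x‖ := by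
        refine Finset.sum_le_sum fun k _ => ?_
        rw [norm_smul, Complex.norm_real, Real.norm_of_nonneg (wt_pos h0 h1 k).le]
        exact mul_le_mul_of_nonneg_left (norm_blk k x) (wt_pos h0 h1 k).le
    _ = ‖x‖ := by rw [← Finset.sum_mul, wt_sum, one_mul]

lemma schatten_kron {m : ℕ} {p : ℝ} (hp : 1 ≤ p) {α : ℝ} (h0 : 0 < α) (h1 : α ≤ 1 / 2)
    (z : Matrix (Fin m) (Fin m) ℂ) :
    schatten p (kron z (A1t α (1 / p))) ≤ schatten p z := by
  obtain ⟨F, W, d, hF, hW, hF', hW', hd, hx, hx', hs⟩ := svd z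
  have hw : ∀ k, 0 ≤ wt α k ^ (1 / p) := fun k => Real.rpow_nonneg (wt_pos h0 h1 k).le _
  have e : kron z (A1t α (1 / p)) = kron F 1 * Matrix.diagonal (fun a =>
      ((d (finProdFinEquiv.symm a).1 * wt α (finProdFinEquiv.symm a).2 ^ (1 / p) : ℝ) : ℂ)) *
      kron Wᴴ 1 := by
    have := kron_diag (fun k => (d k : ℂ)) (fun k => ((wt α k ^ (1 / p) : ℝ) : ℂ))
    simp only [Complex.ofReal_mul]
    rw [← this, kron_mul, kron_mul, ← hx, ← A1t_eq]
    simp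
  rw [e]
  refine (schatten_le_diag hp _ _ ((norm_kronL F).trans hF) ((norm_kronL _).trans hW') _
    (fun a => mul_nonneg (hd _) (hw _))).trans (le_of_eq ?_)
  rw [hs, sum_fin_prod]
  congr 1
  refine Finset.sum_congr rfl fun i _ => ?_
  simp only [Equiv.symm_apply_apply]
  have : ∀ k, (d i * wt α k ^ (1 / p)) ^ p = d i ^ p * wt α k := fun k => by
    rw [Real.mul_rpow (hd i) (hw k), rpow_one_div_rpow hp (wt_pos h0 h1 k).le]
  simp only [this, ← Finset.mul_sum, wt_sum, mul_one]

lemma toReal_ge {p : ℝ≥0∞} (hp : 1 ≤ p) (h : p ≠ ∞) : 1 ≤ p.toReal := by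
  have := ENNReal.toReal_mono h hp
  simpa using this

lemma lp_nonneg (α : ℝ) (p : ℝ≥0∞) {ν : ℕ} (x : Matrix (Fin (2 ^ ν)) (Fin (2 ^ ν)) ℂ) :
    0 ≤ lpSharp α p x := by
  unfold lpSharp
  split_ifs
  · exact norm_nonneg _
  · exact schatten_nonneg _ _

lemma lp_add (α : ℝ) {p : ℝ≥0∞} (hp : 1 ≤ p) {ν : ℕ}
    (x y : Matrix (Fin (2 ^ ν)) (Fin (2 ^ ν)) ℂ) :
    lpSharp α p (x + y) ≤ lpSharp α p x + lpSharp α p y := by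
  unfold lpSharp
  split_ifs with h
  · simp only [opNorm_eq]; exact norm_add_le _ _
  · rw [Matrix.add_mul]; exact schatten_add_le (toReal_ge hp h) _ _

lemma lp_diag (α : ℝ) {p : ℝ≥0∞} (hp : 1 ≤ p) {ν : ℕ}
    (x : Matrix (Fin (2 ^ ν)) (Fin (2 ^ ν)) ℂ) (u v : Fin (2 ^ ν) → ℂ)
    (hu : ∀ i, ‖u i‖ ≤ 1) (hv : ∀ i, ‖v i‖ ≤ 1) :
    lpSharp α p (Matrix.diagonal u * x * Matrix.diagonal v) ≤ lpSharp α p x := by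
  have hu' := norm_diagonal_le_one u hu
  have hv' := norm_diagonal_le_one v hv
  unfold lpSharp
  split_ifs with h
  · simp only [opNorm_eq]
    calc ‖Matrix.diagonal u * x * Matrix.diagonal v‖ ≤ ‖Matrix.diagonal u * x‖ :=
          (norm_mul_le _ _).trans (mul_le_of_le_one_right (norm_nonneg _) hv')
      _ ≤ ‖x‖ := (norm_mul_le _ _).trans (mul_le_of_le_one_left (norm_nonneg _) hu')
  · obtain ⟨w, hw⟩ := Amatt_diag α (1 / p.toReal) ν
    have e : Matrix.diagonal u * x * Matrix.diagonal v * Amatt α (1 / p.toReal) ν =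
        Matrix.diagonal u * (x * Amatt α (1 / p.toReal) ν) * Matrix.diagonal v := by
      rw [hw]
      simp only [Matrix.mul_assoc, Matrix.diagonal_mul_diagonal]
      simp only [mul_comm]
    rw [e]
    exact schatten_contr (toReal_ge hp h) _ _ _ hu' hv'

lemma lp_kron {α : ℝ} (h0 : 0 < α) (h1 : α ≤ 1 / 2) {p : ℝ≥0∞} (hp : 1 ≤ p) {ν : ℕ}
    (y : Matrix (Fin (2 ^ ν)) (Fin (2 ^ ν)) ℂ) (s : Matrix (Fin 2) (Fin 2) ℂ) :
    lpSharp α p (ν := ν + 1) (kron y s) ≤ lpSharp α p y * opNorm s := by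
  unfold lpSharp
  split_ifs with h
  · simp only [opNorm_eq]
    have e : kron y s = kron y 1 * kron 1 s := by rw [kron_mul]; simp
    rw [e]
    exact (norm_mul_le _ _).trans (mul_le_mul (norm_kronL y) (norm_kronR s) (norm_nonneg _)
      (norm_nonneg _))
  · have hq := toReal_ge hp h
    have e : (kron y s * kron (Amatt α (1 / p.toReal) ν) (A1t α (1 / p.toReal))) =
        kron 1 s * kron (y * Amatt α (1 / p.toReal) ν) (A1t α (1 / p.toReal)) := by
      rw [kron_mul, kron_mul, Matrix.one_mul]
    change schatten p.toReal (kron y s * kron (Amatt α (1 / p.toReal) ν) (A1t α (1 / p.toReal))) ≤ _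
    rw [e, mul_comm (schatten _ _)]
    exact (schatten_mul_left hq _ _).trans (mul_le_mul (norm_kronR s)
      (schatten_kron hq h0 h1 _) (schatten_nonneg _ _) (norm_nonneg _))

lemma lp_cE {α : ℝ} (h0 : 0 < α) (h1 : α ≤ 1 / 2) {p : ℝ≥0∞} (hp : 1 ≤ p) {ν : ℕ}
    (x : Matrix (Fin (2 ^ ν * 2)) (Fin (2 ^ ν * 2)) ℂ) (s : Matrix (Fin 2) (Fin 2) ℂ) :
    lpSharp α p (cE α (kron 1 sᴴ * x)) ≤ opNorm s * lpSharp α p (ν := ν + 1) x := by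
  have hs : ‖kron (1 : Matrix (Fin (2 ^ ν)) (Fin (2 ^ ν)) ℂ) sᴴ‖ ≤ ‖s‖ :=
    (norm_kronR _).trans (Matrix.l2_opNorm_conjTranspose s).le
  unfold lpSharp
  split_ifs with h
  · simp only [opNorm_eq]
    exact (norm_cE h0 h1 _).trans ((norm_mul_le _ _).trans
      (mul_le_mul_of_nonneg_right hs (norm_nonneg _)))
  · have hq := toReal_ge hp h
    refine (cE_schatten hq h0 h1 _ _).trans ?_
    rw [Matrix.mul_assoc]
    exact (schatten_mul_left hq _ _).trans (mul_le_mul_of_nonneg_right hs (schatten_nonneg _ _))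

lemma lp2_nonneg (α : ℝ) (p : ℝ≥0∞) (x : Matrix (Fin 2) (Fin 2) ℂ) :
    0 ≤ lp2Sharp α p x := by
  unfold lp2Sharp
  split_ifs
  · exact norm_nonneg _
  · exact schatten_nonneg _ _

lemma lp2_add (α : ℝ) {p : ℝ≥0∞} (hp : 1 ≤ p) (x y : Matrix (Fin 2) (Fin 2) ℂ) :
    lp2Sharp α p (x + y) ≤ lp2Sharp α p x + lp2Sharp α p y := by
  unfold lp2Sharp
  split_ifs with h
  · simp only [opNorm_eq]; exact norm_add_le _ _
  · rw [Matrix.add_mul]; exact schatten_add_le (toReal_ge hp h) _ _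

lemma lp2_smul (α : ℝ) {p : ℝ≥0∞} (hp : 1 ≤ p) (c : ℂ) (x : Matrix (Fin 2) (Fin 2) ℂ) :
    lp2Sharp α p (c • x) ≤ ‖c‖ * lp2Sharp α p x := by
  unfold lp2Sharp
  split_ifs with h
  · simp only [opNorm_eq]; exact (norm_smul c x).le
  · rw [Matrix.smul_mul]; exact schatten_smul (toReal_ge hp h) _ _

lemma entry_le {N : ℕ} (x : Matrix (Fin N) (Fin N) ℂ) (i j : Fin N) : ‖x i j‖ ≤ ‖x‖ := by
  have h := Matrix.l2_opNorm_mulVec x (EuclideanSpace.single j (1 : ℂ))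
  have h2 := EuclideanSpace.norm_eq
    (WithLp.toLp 2 (x.mulVec (EuclideanSpace.single j (1 : ℂ))))
  have h3 : ‖x i j‖ ≤ ‖WithLp.toLp 2 (x.mulVec (EuclideanSpace.single j (1 : ℂ)))‖ := by
    have := PiLp.norm_apply_le (WithLp.toLp 2 (x.mulVec (EuclideanSpace.single j (1 : ℂ)))) i
    simpa [Matrix.mulVec_single] using this
  refine h3.trans (h.trans ?_)
  simp

lemma rho1_eq (α : ℝ) (x : Matrix (Fin 2) (Fin 2) ℂ) :
    rho1 α x = ∑ k, (wt α k : ℂ) * x k k := by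
  simp only [rho1, A1_eq, Matrix.trace, Matrix.diag_apply, Matrix.mul_diagonal]
  exact Finset.sum_congr rfl fun k _ => by ring

lemma norm_rho1_le {α : ℝ} (h0 : 0 < α) (h1 : α ≤ 1 / 2) (x : Matrix (Fin 2) (Fin 2) ℂ) :
    ‖rho1 α x‖ ≤ ∑ k, wt α k * ‖x k k‖ := by
  rw [rho1_eq]
  refine (norm_sum_le _ _).trans (Finset.sum_le_sum fun k _ => ?_)
  rw [norm_mul, Complex.norm_real, Real.norm_of_nonneg (wt_pos h0 h1 k).le]

lemma lp2_rho {α : ℝ} (h0 : 0 < α) (h1 : α ≤ 1 / 2) {p : ℝ≥0∞} (hp : 1 ≤ p)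
    (x s : Matrix (Fin 2) (Fin 2) ℂ) :
    ‖rho1 α (sᴴ * x)‖ ≤ opNorm s * lp2Sharp α p x := by
  have hs : ‖sᴴ‖ = ‖s‖ := Matrix.l2_opNorm_conjTranspose s
  unfold lp2Sharp
  split_ifs with h
  · simp only [opNorm_eq]
    calc ‖rho1 α (sᴴ * x)‖ ≤ ∑ k, wt α k * ‖(sᴴ * x) k k‖ := norm_rho1_le h0 h1 _
      _ ≤ ∑ k, wt α k * ‖sᴴ * x‖ := Finset.sum_le_sum fun k _ =>
          mul_le_mul_of_nonneg_left (entry_le _ _ _) (wt_pos h0 h1 k).le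
      _ = ‖sᴴ * x‖ := by rw [← Finset.sum_mul, wt_sum, one_mul]
      _ ≤ _ := (norm_mul_le _ _).trans (by rw [hs])
  · have hq := toReal_ge hp h
    set q := p.toReal
    have h2 := schatten_mul_left hq (x * A1t α (1 / q)) sᴴ
    rw [hs] at h2
    refine le_trans ?_ h2
    apply le_of_rpow hq (schatten_nonneg _ _)
    have h3 := schatten_var hq (sᴴ * (x * A1t α (1 / q))) 1 1 norm_one_le norm_one_le
    refine le_trans ?_ h3
    refine (Real.rpow_le_rpow (norm_nonneg _) (norm_rho1_le h0 h1 _) (by linarith)).trans ?_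
    refine (jensen_sub Finset.univ hq (wt α) _ (fun k => (wt_pos h0 h1 k).le)
      (fun k => norm_nonneg _) (wt_sum α).le).trans (le_of_eq ?_)
    refine Finset.sum_congr rfl fun k _ => ?_
    have hw := (wt_pos h0 h1 k).le
    rw [Matrix.one_mul, Matrix.mul_one, ← Matrix.mul_assoc, A1t_eq, Matrix.mul_diagonal, norm_mul,
      Complex.norm_real, Real.norm_of_nonneg (Real.rpow_nonneg hw _),
      Real.mul_rpow (norm_nonneg _) (Real.rpow_nonneg hw _), rpow_one_div_rpow hq hw, mul_comm]

end helpers2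

section combin

lemma shell_lt {N r c : ℕ} (hr : r < N) (hc : c < N) : shellNum r c < N * N := by
  unfold shellNum
  split_ifs with h
  · nlinarith
  · have : r * r + 2 * r < N * N := by nlinarith
    omega

lemma shell_split (k : ℕ) : ∃ P1 P1' P2 P2' : ℕ → Prop, ∀ r c,
    (shellNum r c < k ↔ (P1 r ∧ P1' c) ∨ (P2 r ∧ P2' c)) ∧
      ¬ ((P1 r ∧ P1' c) ∧ (P2 r ∧ P2' c)) := by
  obtain ⟨n, t, hk, ht⟩ : ∃ n t, k = n * n + t ∧ t ≤ 2 * n := by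
    refine ⟨Nat.sqrt k, k - Nat.sqrt k * Nat.sqrt k, ?_, ?_⟩
    · have := Nat.sqrt_le k; omega
    · have := Nat.sqrt_le_add k; omega
  subst hk
  have key : ∀ r c, shellNum r c < n * n + t ↔
      (r < n ∧ c < n) ∨ (c = n ∧ r ≤ n ∧ r < t) ∨ (r = n ∧ c < n ∧ 2 * n < c + t) := by
    intro r c
    unfold shellNum
    split_ifs with h
    · rcases lt_trichotomy c n with hc | hc | hc
      · have : c * c + r < n * n := by nlinarith
        constructor
        · intro _; left; omega
        · intro _; omega
      · subst hc; constructor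
        · intro _; right; left; omega
        · rintro (h | h | h) <;> omega
      · have : n * n + 2 * n + 1 ≤ c * c := by nlinarith
        constructor
        · intro _; omega
        · rintro (h | h | h) <;> omega
    · rcases lt_trichotomy r n with hc | hc | hc
      · have : r * r + 2 * r + 1 ≤ n * n := by nlinarith
        constructor
        · intro _; left; omega
        · intro _; omega
      · subst hc; constructor
        · intro _; right; right; omega
        · rintro (h | h | h) <;> omega
      · have : n * n + 2 * n + 1 ≤ r * r := by nlinarith
        constructor
        · intro _; omega
        · rintro (h | h | h) <;> omega
  by_cases h : t ≤ n
  · refine ⟨fun r => r < n, fun c => c < n, fun r => r < t, fun c => c = n, fun r c => ?_⟩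
    rw [key]
    constructor
    · omega
    · omega
  · refine ⟨fun r => r < n, fun c => c ≤ n, fun r => r = n, fun c => c ≤ n ∧ 2 * n < c + t,
      fun r c => ?_⟩
    rw [key]
    constructor
    · omega
    · omega

open Classical in
lemma lp_trunc (α : ℝ) {p : ℝ≥0∞} (hp : 1 ≤ p) {ν : ℕ} (k : ℕ)
    (y : Matrix (Fin (2 ^ ν)) (Fin (2 ^ ν)) ℂ) :
    lpSharp α p (ν := ν) (Matrix.of fun r c => if shellNum (r : ℕ) (c : ℕ) < k then y r c else 0) ≤
      2 * lpSharp α p y := by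
  obtain ⟨P1, P1', P2, P2', h⟩ := shell_split k
  let ind : (ℕ → Prop) → Fin (2 ^ ν) → ℂ := fun P i => if P (i : ℕ) then 1 else 0
  have hind : ∀ P i, ‖ind P i‖ ≤ 1 := by
    intro P i
    simp only [ind]
    split_ifs <;> simp
  have e : (Matrix.of fun r c : Fin (2 ^ ν) =>
      if shellNum (r : ℕ) (c : ℕ) < k then y r c else 0) =
      Matrix.diagonal (ind P1) * y * Matrix.diagonal (ind P1') +
      Matrix.diagonal (ind P2) * y * Matrix.diagonal (ind P2') := by
    ext r c
    obtain ⟨ha, hb⟩ := h r c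
    simp only [Matrix.of_apply, Matrix.add_apply, Matrix.mul_diagonal, Matrix.diagonal_mul, ind, ha]
    by_cases a1 : P1 r <;> by_cases a2 : P1' c <;> by_cases a3 : P2 r <;> by_cases a4 : P2' c <;>
      simp_all
  rw [e]
  have h1 := lp_add α hp (Matrix.diagonal (ind P1) * y * Matrix.diagonal (ind P1'))
    (Matrix.diagonal (ind P2) * y * Matrix.diagonal (ind P2'))
  have h2 := lp_diag α hp y (ind P1) (ind P1') (hind _) (hind _)
  have h3 := lp_diag α hp y (ind P2) (ind P2') (hind _) (hind _)
  linarith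

lemma sum_eUnit (N k : ℕ) (a : ℕ → ℂ) :
    ∑ j ∈ Finset.range k, a j • eUnit N j =
      Matrix.of fun r c : Fin N => if shellNum (r : ℕ) (c : ℕ) < k then
        a (shellNum (r : ℕ) (c : ℕ)) else 0 := by
  ext r c
  simp [Matrix.sum_apply, eUnit]

lemma lp_eUnit (α : ℝ) {p : ℝ≥0∞} (hp : 1 ≤ p) (ν k : ℕ) (a : ℕ → ℂ) :
    lpSharp α p (∑ j ∈ Finset.range k, a j • eUnit (2 ^ ν) j) ≤
      2 * lpSharp α p (∑ j ∈ Finset.range (4 ^ ν), a j • eUnit (2 ^ ν) j) := by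
  have h := lp_trunc α hp k (∑ j ∈ Finset.range (4 ^ ν), a j • eUnit (2 ^ ν) j)
  refine le_trans (le_of_eq ?_) h
  congr 1
  rw [sum_eUnit, sum_eUnit]
  ext r c
  have h4 : (4 : ℕ) ^ ν = 2 ^ ν * 2 ^ ν := by rw [← mul_pow]; norm_num
  have := shell_lt r.2 c.2
  simp only [Matrix.of_apply]
  rw [if_pos (show shellNum (r : ℕ) (c : ℕ) < 4 ^ ν by rw [h4]; exact this)]

lemma haar_succ (r : ℕ → Matrix (Fin 2) (Fin 2) ℂ) {ν : ℕ} (hν : 1 ≤ ν) (j : ℕ) :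
    haar r (ν + 1) j = if j / 4 ^ ν = 0 then kron (haar r ν j) (r 0)
      else kron (eUnit (2 ^ ν) (j % 4 ^ ν)) (r (j / 4 ^ ν % 4)) := by
  obtain ⟨μ, rfl⟩ : ∃ μ, ν = μ + 1 := ⟨ν - 1, by omega⟩
  rfl

lemma kron_sum_left {m n : ℕ} (s : Finset ℕ) (f : ℕ → Matrix (Fin m) (Fin m) ℂ)
    (y : Matrix (Fin n) (Fin n) ℂ) : kron (∑ i ∈ s, f i) y = ∑ i ∈ s, kron (f i) y := by
  induction s using Finset.induction_on with
  | empty => simp [kron_zero_left]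
  | insert a s ha ih => rw [Finset.sum_insert ha, Finset.sum_insert ha, kron_add_left, ih]

lemma core {N M : ℕ} (hM : 0 < M) (α : ℝ) (r : ℕ → Matrix (Fin 2) (Fin 2) ℂ)
    (hr : ∀ j < 4, ∀ k < 4, rho1 α ((r j)ᴴ * r k) = if j = k then 1 else 0)
    (n : Matrix (Fin N) (Fin N) ℂ → ℝ) (nL : Matrix (Fin (N * 2)) (Fin (N * 2)) ℂ → ℝ)
    (hL0 : ∀ x, 0 ≤ nL x)
    (hadd : ∀ x y, nL (x + y) ≤ nL x + nL y)
    (hk : ∀ y s, nL (kron y s) ≤ n y * opNorm s)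
    (hE : ∀ x s, n (cE α (kron 1 sᴴ * x)) ≤ opNorm s * nL x)
    (bb : ℕ → ℕ → Matrix (Fin N) (Fin N) ℂ) (H : ℕ → Matrix (Fin (N * 2)) (Fin (N * 2)) ℂ)
    (hH : ∀ q < 4, ∀ i < M, H (M * q + i) = kron (bb q i) (r q)) (c : ℝ) (hc0 : 0 ≤ c)
    (hc : ∀ k < M, ∀ a : ℕ → ℂ, n (∑ i ∈ Finset.range (k + 1), a i • bb 0 i) ≤
      c * n (∑ i ∈ Finset.range M, a i • bb 0 i))
    (h2 : ∀ q, 1 ≤ q → q < 4 → ∀ k < M, ∀ a : ℕ → ℂ,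
      n (∑ i ∈ Finset.range (k + 1), a i • bb q i) ≤
      2 * n (∑ i ∈ Finset.range M, a i • bb q i)) :
    ∀ m < M * 4, ∀ a : ℕ → ℂ, nL (∑ j ∈ Finset.range (m + 1), a j • H j) ≤
      max (c * opNorm (r 0) ^ 2)
        (opNorm (r 0) ^ 2 + 2 * (opNorm (r 1) ^ 2 + opNorm (r 2) ^ 2 + opNorm (r 3) ^ 2)) *
      nL (∑ j ∈ Finset.range (M * 4), a j • H j) := by
  intro m hm a
  have ho : ∀ q, 0 ≤ opNorm (r q) := fun q => norm_nonneg _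
  set Y : ℕ → ℕ → Matrix (Fin N) (Fin N) ℂ :=
    fun q k => ∑ i ∈ Finset.range k, a (M * q + i) • bb q i with hY
  have hblock : ∀ q < 4, ∀ k ≤ M, ∑ i ∈ Finset.range k, a (M * q + i) • H (M * q + i) =
      kron (Y q k) (r q) := by
    intro q hq k hk
    rw [hY, kron_sum_left]
    refine Finset.sum_congr rfl fun i hi => ?_
    rw [hH q hq i (lt_of_lt_of_le (Finset.mem_range.1 hi) hk), kron_smul_left]
  have hfull : ∀ q ≤ 4, ∑ j ∈ Finset.range (M * q), a j • H j =
      ∑ q' ∈ Finset.range q, kron (Y q' M) (r q') := by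
    intro q
    induction q with
    | zero => intro _; simp
    | succ q ih =>
      intro hq
      rw [Nat.mul_succ M q, Finset.sum_range_add, ih (by omega), Finset.sum_range_succ,
        hblock q (by omega) M le_rfl]
  set X := ∑ j ∈ Finset.range (M * 4), a j • H j with hX
  have hXe : X = ∑ q' ∈ Finset.range 4, kron (Y q' M) (r q') := hfull 4 le_rfl
  have hcE : ∀ q < 4, cE α (kron 1 (r q)ᴴ * X) = Y q M := by
    intro q hq
    rw [hXe]
    simp only [Finset.sum_range_succ, Finset.sum_range_zero, zero_add, Matrix.mul_add, cE_add,
      kron_mul, cE_kron, Matrix.one_mul]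
    rw [hr q hq 0 (by omega), hr q hq 1 (by omega), hr q hq 2 (by omega), hr q hq 3 (by omega)]
    interval_cases q <;> simp
  have hYX : ∀ q < 4, n (Y q M) ≤ opNorm (r q) * nL X := by
    intro q hq
    rw [← hcE q hq]; exact hE X (r q)
  have hkY : ∀ q < 4, nL (kron (Y q M) (r q)) ≤ opNorm (r q) ^ 2 * nL X := by
    intro q hq
    refine (hk _ _).trans ?_
    have := mul_le_mul_of_nonneg_right (hYX q hq) (ho q)
    nlinarith
  have hk2 : ∀ q, 1 ≤ q → q < 4 → ∀ k < M,
      nL (kron (Y q (k + 1)) (r q)) ≤ 2 * opNorm (r q) ^ 2 * nL X := by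
    intro q hq1 hq k hkM
    refine (hk _ _).trans ?_
    have h1 := h2 q hq1 hq k hkM (fun i => a (M * q + i))
    have h3 := hYX q hq
    have h4 : n (Y q (k + 1)) ≤ 2 * (opNorm (r q) * nL X) := h1.trans (by linarith)
    have := mul_le_mul_of_nonneg_right h4 (ho q)
    nlinarith
  have hmd : M * (m / M) + m % M = m := Nat.div_add_mod m M
  have hk' : m % M < M := Nat.mod_lt _ hM
  have hq' : m / M < 4 := Nat.div_lt_of_lt_mul hm
  generalize m / M = q at hmd hq'
  generalize m % M = k at hmd hk'
  have hS : ∑ j ∈ Finset.range (m + 1), a j • H j =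
      ∑ q' ∈ Finset.range q, kron (Y q' M) (r q') + kron (Y q (k + 1)) (r q) := by
    rw [← hmd, add_assoc, Finset.sum_range_add, hfull q hq'.le, hblock q hq' (k + 1) hk']
  rw [hS]
  have hX0 := hL0 X
  have s0 := mul_nonneg (sq_nonneg (opNorm (r 0))) hX0
  have s1 := mul_nonneg (sq_nonneg (opNorm (r 1))) hX0
  have s2 := mul_nonneg (sq_nonneg (opNorm (r 2))) hX0
  have s3 := mul_nonneg (sq_nonneg (opNorm (r 3))) hX0
  by_cases hq0 : q = 0
  · subst hq0
    refine le_trans ?_ (mul_le_mul_of_nonneg_right (le_max_left _ _) hX0)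
    rw [Finset.sum_range_zero, zero_add]
    refine (hk _ _).trans ?_
    have h1 := hc k hk' (fun i => a (M * 0 + i))
    have h3 := hYX 0 (by omega)
    have h4 : n (Y 0 (k + 1)) ≤ c * (opNorm (r 0) * nL X) :=
      h1.trans (mul_le_mul_of_nonneg_left h3 hc0)
    have := mul_le_mul_of_nonneg_right h4 (ho 0)
    nlinarith
  · refine le_trans ?_ (mul_le_mul_of_nonneg_right (le_max_right _ _) hX0)
    have hl := hk2 q (by omega) hq' k hk'
    have k0 := hkY 0 (by omega)
    have k1 := hkY 1 (by omega)
    have k2 := hkY 2 (by omega)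
    refine (hadd _ _).trans ?_
    have hq1 : q = 1 ∨ q = 2 ∨ q = 3 := by omega
    rcases hq1 with rfl | rfl | rfl
    · simp only [Finset.sum_range_succ, Finset.sum_range_zero, zero_add]
      linarith
    · simp only [Finset.sum_range_succ, Finset.sum_range_zero, zero_add]
      have t1 := hadd (kron (Y 0 M) (r 0)) (kron (Y 1 M) (r 1))
      linarith
    · simp only [Finset.sum_range_succ, Finset.sum_range_zero, zero_add]
      have t1 := hadd (kron (Y 0 M) (r 0)) (kron (Y 1 M) (r 1))
      have t2 := hadd (kron (Y 0 M) (r 0) + kron (Y 1 M) (r 1)) (kron (Y 2 M) (r 2))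
      linarith

end combin

/-- `L^p` version of the Haar basis constant estimates:
`c^{(p)}_{1,♯} ≤ Σ ‖r_j‖‖r_j‖_{p,♯}` and
`c^{(p)}_{ν+1,♯} ≤ max{c‖r_0‖², ‖r_0‖² + 2Σ_{q=1}^3 ‖r_q‖²}`. -/
theorem haar_basis_constants_lp_sharp
    (α : ℝ) (hα0 : 0 < α) (hα : α ≤ 1 / 2)
    (r : ℕ → Matrix (Fin 2) (Fin 2) ℂ)
    (hr : ∀ j < 4, ∀ k < 4, rho1 α ((r j)ᴴ * r k) = if j = k then 1 else 0)
    (p : ℝ≥0∞) (hp : 1 ≤ p) :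
    (∀ m ≤ 3, ∀ a : ℕ → ℂ,
      lp2Sharp α p (∑ j ∈ Finset.range (m + 1), a j • r j) ≤
        (∑ j ∈ Finset.range 4, opNorm (r j) * lp2Sharp α p (r j)) *
          lp2Sharp α p (∑ j ∈ Finset.range 4, a j • r j)) ∧
    (∀ ν, 1 ≤ ν → ∀ c : ℝ, 0 ≤ c →
      (∀ m < 4 ^ ν, ∀ a : ℕ → ℂ,
        lpSharp α p (∑ j ∈ Finset.range (m + 1), a j • haar r ν j) ≤
          c * lpSharp α p (∑ j ∈ Finset.range (4 ^ ν), a j • haar r ν j)) →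
      ∀ m < 4 ^ (ν + 1), ∀ a : ℕ → ℂ,
        lpSharp α p (∑ j ∈ Finset.range (m + 1), a j • haar r (ν + 1) j) ≤
          max (c * opNorm (r 0) ^ 2)
              (opNorm (r 0) ^ 2 + 2 * (opNorm (r 1) ^ 2 + opNorm (r 2) ^ 2 + opNorm (r 3) ^ 2)) *
            lpSharp α p (∑ j ∈ Finset.range (4 ^ (ν + 1)), a j • haar r (ν + 1) j)) := by
  refine ⟨?_, ?_⟩
  · intro m hm a
    set X := ∑ j ∈ Finset.range 4, a j • r j with hX
    have ha : ∀ j < 4, a j = rho1 α ((r j)ᴴ * X) := by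
      intro j hj
      have e : rho1 α ((r j)ᴴ * X) = ∑ k ∈ Finset.range 4, a k * rho1 α ((r j)ᴴ * r k) := by
        simp only [rho1, hX, Matrix.mul_sum, Matrix.sum_mul, Matrix.trace_sum, Matrix.mul_smul,
          Matrix.smul_mul, Matrix.trace_smul, smul_eq_mul]
      rw [e, Finset.sum_congr rfl fun k hk => by rw [hr j hj k (Finset.mem_range.1 hk)]]
      simp [hj]
    have h1 : ∀ s : Finset ℕ, lp2Sharp α p (∑ j ∈ s, a j • r j) ≤
        ∑ j ∈ s, ‖a j‖ * lp2Sharp α p (r j) := by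
      intro s
      induction s using Finset.induction_on with
      | empty =>
        have := lp2_smul α hp 0 (0 : Matrix (Fin 2) (Fin 2) ℂ)
        simpa using this
      | insert b s hb ih =>
        rw [Finset.sum_insert hb, Finset.sum_insert hb]
        have := lp2_add α hp (a b • r b) (∑ j ∈ s, a j • r j)
        have := lp2_smul α hp (a b) (r b)
        linarith
    refine (h1 _).trans ?_
    rw [Finset.sum_mul]
    refine (Finset.sum_le_sum_of_subset_of_nonneg
      (Finset.range_subset_range.2 (by omega : m + 1 ≤ 4))
      fun j _ _ => mul_nonneg (norm_nonneg _) (lp2_nonneg _ _ _)).trans ?_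
    refine Finset.sum_le_sum fun j hj => ?_
    have h2 := lp2_rho hα0 hα hp X (r j)
    rw [← ha j (Finset.mem_range.1 hj)] at h2
    have := mul_le_mul_of_nonneg_right h2 (lp2_nonneg α p (r j))
    linarith
  · intro ν hν c hc0 hc m hm a
    have h4 : 0 < 4 ^ ν := by positivity
    have key := core (N := 2 ^ ν) (M := 4 ^ ν) h4 α r hr (fun y => lpSharp α p y)
      (fun x => lpSharp α p (ν := ν + 1) x) (fun x => lp_nonneg _ _ _)
      (fun x y => lp_add (ν := ν + 1) α hp x y) (fun y s => lp_kron hα0 hα hp y s)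
      (fun x s => lp_cE hα0 hα hp x s)
      (fun q i => if q = 0 then haar r ν i else eUnit (2 ^ ν) i)
      (fun j => haar r (ν + 1) j)
      (by
        intro q hq i hi
        have h1 : (4 ^ ν * q + i) / 4 ^ ν = q := by
          rw [Nat.mul_add_div h4, Nat.div_eq_of_lt hi, add_zero]
        have h2 : (4 ^ ν * q + i) % 4 ^ ν = i := by
          rw [Nat.mul_add_mod, Nat.mod_eq_of_lt hi]
        refine (haar_succ r hν _).trans ?_
        rw [h1, h2, Nat.mod_eq_of_lt hq]
        by_cases h : q = 0
        · subst h; simp; rfl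
        · simp only [h, if_false]; rfl)
      c hc0
      (by
        intro k hk b
        simpa using hc k hk b)
      (by
        intro q hq1 hq k hk b
        simpa only [show q ≠ 0 by omega, if_false] using lp_eUnit α hp ν (k + 1) b)
      m (by rw [← pow_succ]; exact hm) a
    exact key

end
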